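/- arXiv:2012.15447 — 2 statements merged into one kernel-verified Lean document; each statement's English description precedes it below -/
import Mathlib

section
/- Let I = B(M,N) ⊆ S = K[x_1, …, x_n] be the strongly stable ideal with Borel generators M = x_a·x_b and N = x_c·x_d, where c < a ≤ b < d, and let μ be a monomial of S. (a) If μ can be written as a product of monomials all belonging to B_M, then in every factorization of μ as a product of elements of B_M ∪ B_N, all factors belong to B_M. (b) If μ can be written as a product of monomials all belonging to B_N, then in every factorization of μ as a product of elements of B_M ∪ B_N, all factors belong to B_N. -/
/-- A marked binomial: the difference of two monomials (given by exponent vectors),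
with `head` chosen as the marked term. -/
structure MarkedBinomial (V : Type*) where
  head : V →₀ ℕ
  tail : V →₀ ℕ

/-- The polynomial associated to a marked binomial. -/
noncomputable def MarkedBinomial.toPoly {V : Type*} (K : Type*) [Field K]
    (g : MarkedBinomial V) : MvPolynomial V K :=
  MvPolynomial.monomial g.head 1 - MvPolynomial.monomial g.tail 1

/-- Transport a marked binomial along a map of variables. -/
noncomputable def MarkedBinomial.map {V W : Type*} (f : V → W) (g : MarkedBinomial V) :
    MarkedBinomial W :=
  ⟨Finsupp.mapDomain f g.head, Finsupp.mapDomain f g.tail⟩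

/-- A monomial order on the exponent vectors `V →₀ ℕ`: a strict total order, compatible
with addition, for which `1` (the zero exponent vector) is the smallest monomial. -/
structure MonomialOrd (V : Type*) where
  gt : (V →₀ ℕ) → (V →₀ ℕ) → Prop
  irrefl : ∀ m, ¬ gt m m
  trans : ∀ {m₁ m₂ m₃}, gt m₁ m₂ → gt m₂ m₃ → gt m₁ m₃
  total : ∀ m₁ m₂, m₁ ≠ m₂ → gt m₁ m₂ ∨ gt m₂ m₁
  add_right : ∀ {m₁ m₂} (m₃), gt m₁ m₂ → gt (m₁ + m₃) (m₂ + m₃)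
  gt_zero : ∀ m, m ≠ 0 → gt m 0

/-- `m` is the initial (leading) exponent of `f` with respect to the strict order `gt`. -/
def IsInitialTerm {V K : Type*} [Field K] (gt : (V →₀ ℕ) → (V →₀ ℕ) → Prop)
    (f : MvPolynomial V K) (m : V →₀ ℕ) : Prop :=
  m ∈ f.support ∧ ∀ m' ∈ f.support, m' ≠ m → gt m m'

/-- A set `G` of marked binomials is a Gröbner basis of the ideal `J` with respect to the
order `gt`, with the marked terms as initial terms: `G ⊆ J`, each marked term is the
initial term of its binomial, and the marked terms generate the initial ideal of `J`. -/
def IsMarkedGB {V K : Type*} [Field K] (gt : (V →₀ ℕ) → (V →₀ ℕ) → Prop)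
    (G : Set (MarkedBinomial V)) (J : Ideal (MvPolynomial V K)) : Prop :=
  (∀ g ∈ G, g.toPoly K ∈ J) ∧ (∀ g ∈ G, gt g.head g.tail) ∧
    Ideal.span ((fun g => (MvPolynomial.monomial g.head (1 : K) : MvPolynomial V K)) '' G) =
      Ideal.span {p : MvPolynomial V K |
        ∃ f ∈ J, f ≠ 0 ∧ ∃ m, IsInitialTerm gt f m ∧ p = MvPolynomial.monomial m (1 : K)}

/-- One-step reduction of a monomial (exponent vector) with respect to a collection of
marked binomials: replace an occurrence of a marked term by the corresponding tail. -/
def Reduces {V : Type*} (G : Set (MarkedBinomial V)) (m m' : V →₀ ℕ) : Prop :=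
  ∃ g ∈ G, g.head ≤ m ∧ m' = m - g.head + g.tail

/-- One-step reduction of a polynomial with respect to a collection of marked binomials. -/
noncomputable def PolyReduces {V K : Type*} [Field K] (G : Set (MarkedBinomial V))
    (f f' : MvPolynomial V K) : Prop :=
  ∃ g ∈ G, ∃ m ∈ f.support, g.head ≤ m ∧
    f' = f - MvPolynomial.monomial (m - g.head) (MvPolynomial.coeff m f) * g.toPoly K

/-- The image monomial (in the `W`-variables) of a monomial `T` in the `V`-variables under
the monomial map sending the variable `v` to the monomial with exponent vector `u v`. -/
noncomputable def fiberMap {V W : Type*} (u : V → (W →₀ ℕ)) (T : V →₀ ℕ) : W →₀ ℕ :=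
  T.sum fun v e => e • u v

/-- `T` is a sink of the fiber graph over the multidegree `μ` (with respect to the
marked binomials `G` and the monomial map determined by `u`): it lies in the fiber and
has no outgoing edge inside the fiber. -/
noncomputable def IsFiberSink {V W : Type*} (G : Set (MarkedBinomial V)) (u : V → (W →₀ ℕ))
    (μ : W →₀ ℕ) (T : V →₀ ℕ) : Prop :=
  fiberMap u T = μ ∧ ∀ T', Reduces G T T' → fiberMap u T' ≠ μ

/-- `I` is a monomial ideal. -/
def IsMonomialIdeal {n : ℕ} {K : Type*} [Field K] (I : Ideal (MvPolynomial (Fin n) K)) : Prop :=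
  ∃ M : Set (Fin n →₀ ℕ), I = Ideal.span ((fun m => (MvPolynomial.monomial m (1 : K))) '' M)

/-- `I` is a strongly stable (Borel) ideal: a monomial ideal such that whenever `x_i`
divides a monomial `m ∈ I` and `j < i`, also `x_j · m / x_i ∈ I`. -/
def StronglyStable {n : ℕ} {K : Type*} [Field K] (I : Ideal (MvPolynomial (Fin n) K)) : Prop :=
  IsMonomialIdeal I ∧ ∀ m : Fin n →₀ ℕ, MvPolynomial.monomial m (1 : K) ∈ I →
    ∀ i j : Fin n, j < i → m i ≠ 0 →
      MvPolynomial.monomial (m - Finsupp.single i 1 + Finsupp.single j 1) (1 : K) ∈ I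

/-- The smallest strongly stable ideal containing the given monomials. -/
noncomputable def smallestStronglyStable {n : ℕ} (K : Type*) [Field K]
    (Ms : Set (Fin n →₀ ℕ)) : Ideal (MvPolynomial (Fin n) K) :=
  sInf {I | StronglyStable I ∧ ∀ m ∈ Ms, MvPolynomial.monomial m (1 : K) ∈ I}

/-- The minimal monomial generators of an ideal generated in the single degree `d`:
the degree-`d` monomials lying in `I`. -/
def MinGens {n : ℕ} {K : Type*} [Field K] (I : Ideal (MvPolynomial (Fin n) K)) (d : ℕ) :
    Set (Fin n →₀ ℕ) :=
  {m | (m.sum fun _ e => e) = d ∧ MvPolynomial.monomial m (1 : K) ∈ I}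

/-- `u ≻_rlex v` (reverse lexicographic, `x_1 > … > x_n`, for exponent vectors of equal
total degree): at the largest index where they differ, `u` has the smaller exponent. -/
def RlexGt {n : ℕ} (u v : Fin n →₀ ℕ) : Prop :=
  ∃ k : Fin n, u k < v k ∧ ∀ l : Fin n, k < l → u l = v l

/-- The (degree-)reverse lexicographic order on monomials of `K[V]` induced by the strict
variable order `vgt` (where `vgt k l` means the variable `k` is greater than `l`). -/
def VarRevlexGt {V : Type*} (vgt : V → V → Prop) (m m' : V →₀ ℕ) : Prop :=
  (m.sum fun _ e => e) > (m'.sum fun _ e => e) ∨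
    ((m.sum fun _ e => e) = (m'.sum fun _ e => e) ∧
      ∃ k, m k < m' k ∧ ∀ l, vgt k l → m l = m' l)

/-- The minimal monomial generators of the strongly stable ideal `B(x_a x_b)` (`a ≤ b`):
the monomials `x_i x_j` with `i ≤ j`, `i ≤ a`, `j ≤ b`. -/
def BM {n : ℕ} (a b : Fin n) : Set (Fin n →₀ ℕ) :=
  {m | ∃ i j : Fin n, i ≤ j ∧ i ≤ a ∧ j ≤ b ∧ m = Finsupp.single i 1 + Finsupp.single j 1}

/-- The minimal monomial generators of `B(x_c x_d)` not in `B(x_a x_b)` (for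
`c < a ≤ b < d`): the monomials `x_i x_j` with `i ≤ c` and `b < j ≤ d`. -/
def BN {n : ℕ} (b c d : Fin n) : Set (Fin n →₀ ℕ) :=
  {m | ∃ i j : Fin n, i ≤ c ∧ b < j ∧ j ≤ d ∧ m = Finsupp.single i 1 + Finsupp.single j 1}

/-- `u ≻_mrlex v`: every element of `B_N` is greater than every element of `B_M`, and
within `B_M` (resp. `B_N`) the order agrees with `≻_rlex`. -/
def MrlexGt {n : ℕ} (a b c d : Fin n) (u v : Fin n →₀ ℕ) : Prop :=
  (u ∈ BN b c d ∧ v ∈ BM a b) ∨ (u ∈ BM a b ∧ v ∈ BM a b ∧ RlexGt u v) ∨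
    (u ∈ BN b c d ∧ v ∈ BN b c d ∧ RlexGt u v)

/-- The collection `G₁` of marked binomials `T_u T_v − T_{u'} T_{v'}` with `u v = u' v'`
and `u, v ≻_rlex v'`, marked at `T_u T_v`. -/
def G1 {n : ℕ} (a b c d : Fin n) : Set (MarkedBinomial ↥(BM a b ∪ BN b c d)) :=
  {g | ∃ u v u' v' : ↥(BM a b ∪ BN b c d),
    (u : Fin n →₀ ℕ) + (v : Fin n →₀ ℕ) = (u' : Fin n →₀ ℕ) + (v' : Fin n →₀ ℕ) ∧
    RlexGt (u : Fin n →₀ ℕ) (v' : Fin n →₀ ℕ) ∧ RlexGt (v : Fin n →₀ ℕ) (v' : Fin n →₀ ℕ) ∧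
    g.head = Finsupp.single u 1 + Finsupp.single v 1 ∧
    g.tail = Finsupp.single u' 1 + Finsupp.single v' 1}

/-- The collection `G₂` of marked binomials `T_u T_v − T_{u'} T_{v'}` with `u v = u' v'`
and `u, v ≻_mrlex v'`, marked at `T_u T_v`. -/
def G2 {n : ℕ} (a b c d : Fin n) : Set (MarkedBinomial ↥(BM a b ∪ BN b c d)) :=
  {g | ∃ u v u' v' : ↥(BM a b ∪ BN b c d),
    (u : Fin n →₀ ℕ) + (v : Fin n →₀ ℕ) = (u' : Fin n →₀ ℕ) + (v' : Fin n →₀ ℕ) ∧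
    MrlexGt a b c d (u : Fin n →₀ ℕ) (v' : Fin n →₀ ℕ) ∧
    MrlexGt a b c d (v : Fin n →₀ ℕ) (v' : Fin n →₀ ℕ) ∧
    g.head = Finsupp.single u 1 + Finsupp.single v 1 ∧
    g.tail = Finsupp.single u' 1 + Finsupp.single v' 1}

/-- `w` is the smallest (with respect to the variable order induced by `≻_rlex`) variable
factor of the monomial `T` whose underlying monomial lies in `S`. -/
def IsLeastFactorIn {n : ℕ} {V : Set (Fin n →₀ ℕ)} (S : Set (Fin n →₀ ℕ))
    (T : ↥V →₀ ℕ) (w : ↥V) : Prop :=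
  w ∈ T.support ∧ (w : Fin n →₀ ℕ) ∈ S ∧
    ∀ v ∈ T.support, (v : Fin n →₀ ℕ) ∈ S →
      v = w ∨ RlexGt (v : Fin n →₀ ℕ) (w : Fin n →₀ ℕ)

/-- `m` is the `≻_rlex`-smallest element of `S` dividing `μ`. -/
def IsLeastDivisorIn {n : ℕ} (S : Set (Fin n →₀ ℕ)) (μ m : Fin n →₀ ℕ) : Prop :=
  m ∈ S ∧ m ≤ μ ∧ ∀ m' ∈ S, m' ≤ μ → m' = m ∨ RlexGt m' m

/-- If an additive functional vanishes on `P` and is positive on `Q`, then an element which is a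
sum of members of `P` can be written as a sum of members of `P ∪ Q` only using members of `P`. -/
theorem Multiset.forall_mem_of_sum_eq_of_pos {M : Type*} [AddCommMonoid M] {P Q : Set M}
    (φ : M →+ ℤ) (hP : ∀ m ∈ P, φ m = 0) (hQ : ∀ m ∈ Q, 0 < φ m) {t s : Multiset M}
    (ht : ∀ m ∈ t, m ∈ P) (hs : ∀ m ∈ s, m ∈ P ∪ Q) (hst : s.sum = t.sum) :
    ∀ m ∈ s, m ∈ P := by
  intro m hm
  refine (hs m hm).resolve_right fun hmQ => ?_
  have h_zero : φ s.sum = 0 := by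
    rw [hst, map_multiset_sum]
    refine Multiset.sum_eq_zero fun x hx => ?_
    obtain ⟨y, hy, rfl⟩ := Multiset.mem_map.mp hx
    exact hP y (ht y hy)
  have h_nonneg : ∀ x ∈ s.map φ, 0 ≤ x := by
    intro x hx
    obtain ⟨y, hy, rfl⟩ := Multiset.mem_map.mp hx
    exact (hs y hy).elim (fun h => (hP y h).ge) (fun h => (hQ y h).le)
  have h_le := Multiset.single_le_sum h_nonneg (φ m) (Multiset.mem_map_of_mem φ hm)
  rw [← map_multiset_sum, h_zero] at h_le
  exact (hQ m hmQ).not_ge h_le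

/-- For `I = B(x_a x_b, x_c x_d)` with `c < a ≤ b < d` and a monomial
`μ`: (a) if `μ` is a product of monomials all in `B_M`, then every factorization of `μ`
into elements of `B_M ∪ B_N` uses only elements of `B_M`; (b) if `μ` is a product of
monomials all in `B_N`, then every factorization of `μ` into elements of `B_M ∪ B_N`
uses only elements of `B_N`. -/
theorem typeM_typeN_vertices {n : ℕ} (a b c d : Fin n)
    (h1 : c < a) (h2 : a ≤ b) (h3 : b < d) (μ : Fin n →₀ ℕ) :
    ((∃ s : Multiset (Fin n →₀ ℕ), (∀ m ∈ s, m ∈ BM a b) ∧ s.sum = μ) →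
      ∀ s : Multiset (Fin n →₀ ℕ), (∀ m ∈ s, m ∈ BM a b ∪ BN b c d) → s.sum = μ →
        ∀ m ∈ s, m ∈ BM a b) ∧
    ((∃ s : Multiset (Fin n →₀ ℕ), (∀ m ∈ s, m ∈ BN b c d) ∧ s.sum = μ) →
      ∀ s : Multiset (Fin n →₀ ℕ), (∀ m ∈ s, m ∈ BM a b ∪ BN b c d) → s.sum = μ →
        ∀ m ∈ s, m ∈ BN b c d) := by
  refine ⟨?_, ?_⟩
  · rintro ⟨t, ht, rfl⟩ s hs hst
    refine Multiset.forall_mem_of_sum_eq_of_pos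
      (Finsupp.weight fun k : Fin n => if b < k then (1 : ℤ) else 0) ?_ ?_ ht hs hst
    · rintro _ ⟨i, j, hij, -, hj, rfl⟩
      simp [Finsupp.weight_single, hj.not_gt, (hij.trans hj).not_gt]
    · rintro _ ⟨i, j, hi, hj, -, rfl⟩
      simp [Finsupp.weight_single, hj, ((hi.trans h1.le).trans h2).not_gt]
  · rintro ⟨t, ht, rfl⟩ s hs hst
    refine Multiset.forall_mem_of_sum_eq_of_pos
      (Finsupp.weight fun k : Fin n => if b < k then (-1 : ℤ) else 1) ?_ ?_ ht
      (fun m hm => (hs m hm).symm) hst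
    · rintro _ ⟨i, j, hi, hj, -, rfl⟩
      simp [Finsupp.weight_single, hj, ((hi.trans h1.le).trans h2).not_gt]
    · rintro _ ⟨i, j, hij, -, hj, rfl⟩
      simp [Finsupp.weight_single, hj.not_gt, (hij.trans hj).not_gt]
end

section
/- Let I = B(M,N) ⊆ S = K[x_1, …, x_n] with Borel generators M = x_a·x_b and N = x_c·x_d, c < a ≤ b < d, let G₁ = { T_u T_v − T_{u'} T_{v'} : u·v = u'·v' and u, v ≻_rlex v' } marked at T_u T_v, let μ be a monomial of S, and let T be a vertex of the fiber graph Γ_μ(I) with respect to G₁. (a) If T has at least one variable factor T_n with n ∈ B_N and L_N(T) ≠ T_{N'}, then there is a directed edge in Γ_μ(I) from T to a vertex T' with L_N(T) > L_N(T') ≥ T_{N'} in the variable order induced by ≻_rlex. (b) If T has no variable factor from B_N, has at least one factor from B_M, and L_M(T) ≠ T_{M'}, then there is a directed edge from T to a vertex T' with L_M(T) > L_M(T') ≥ T_{M'}. -/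
open Finsupp (single)

theorem RlexGt.trans {n : ℕ} {u v w : Fin n →₀ ℕ} (huv : RlexGt u v) (hvw : RlexGt v w) :
    RlexGt u w := by
  obtain ⟨k, hk, hk'⟩ := huv
  obtain ⟨m, hm, hm'⟩ := hvw
  rcases lt_trichotomy k m with h | rfl | h
  · exact ⟨m, hk' m h ▸ hm, fun l hl => (hk' l (h.trans hl)).trans (hm' l hl)⟩
  · exact ⟨k, hk.trans hm, fun l hl => (hk' l hl).trans (hm' l hl)⟩
  · exact ⟨k, hm' k h ▸ hk, fun l hl => (hk' l hl).trans (hm' l (h.trans hl))⟩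

theorem RlexGt.irrefl {n : ℕ} (u : Fin n →₀ ℕ) : ¬ RlexGt u u :=
  fun ⟨_, hk, _⟩ => hk.false

/-- A monomial that is at least `v` in the order `≻_rlex` involves no variable beyond the
last one in `v`. -/
theorem le_of_eq_or_rlexGt {n : ℕ} {u v : Fin n →₀ ℕ} (huv : u = v ∨ RlexGt u v) {j : Fin n}
    (hv : ∀ l, j < l → v l = 0) {l : Fin n} (hl : u l ≠ 0) : l ≤ j := by
  by_contra! hjl
  rcases huv with rfl | ⟨k, hk, hk'⟩
  · exact hl (hv l hjl)
  · rcases lt_or_ge k l with h | h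
    · exact hl ((hk' l h).trans (hv l hjl))
    · have := hv k (hjl.trans_le h)
      omega

theorem rlexGt_single_add_single {n : ℕ} {i i' : Fin n} (h : i < i') (j : Fin n) :
    RlexGt (single i 1 + single j 1) (single i' 1 + single j 1) := by
  refine ⟨i', ?_, fun l hl => ?_⟩
  · simp [Finsupp.single_apply, h.ne]
  · simp [Finsupp.single_apply, hl.ne, (h.trans hl).ne]

theorem lt_of_rlexGt_single_add_single {n : ℕ} {i i' j : Fin n}
    (h : RlexGt (single i 1 + single j 1) (single i' 1 + single j 1)) : i < i' := by
  rcases lt_trichotomy i i' with hi | rfl | hi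
  · exact hi
  · exact (RlexGt.irrefl _ h).elim
  · exact (RlexGt.irrefl _ (h.trans (rlexGt_single_add_single hi j))).elim

theorem single_add_single_apply_eq_zero {n : ℕ} {i j l : Fin n} (hi : i ≤ j) (hl : j < l) :
    (single i 1 + single j 1 : Fin n →₀ ℕ) l = 0 := by
  simp [hl.ne, (hi.trans_lt hl).ne]

theorem mem_BM_union_BN_iff {n : ℕ} {a b c d : Fin n} (h1 : c < a) (h2 : a ≤ b)
    {v : Fin n →₀ ℕ} :
    v ∈ BM a b ∪ BN b c d ↔
      ∃ p q : Fin n, (p ≤ a ∧ q ≤ b ∨ p ≤ c ∧ q ≤ d) ∧ v = single p 1 + single q 1 := by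
  constructor
  · rintro (⟨p, q, -, hp, hq, rfl⟩ | ⟨p, q, hp, -, hq, rfl⟩)
    · exact ⟨p, q, Or.inl ⟨hp, hq⟩, rfl⟩
    · exact ⟨p, q, Or.inr ⟨hp, hq⟩, rfl⟩
  · rintro ⟨p, q, hpq, rfl⟩
    by_cases hq : q ≤ b
    · have hp : p ≤ a := hpq.elim And.left fun h => h.1.trans h1.le
      rcases le_total p q with h | h
      · exact Or.inl ⟨p, q, h, hp, hq, rfl⟩
      · exact Or.inl ⟨q, p, h, h.trans hp, hp.trans h2, add_comm _ _⟩
    · obtain ⟨hp, hqd⟩ := hpq.resolve_left fun h => hq h.2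
      exact Or.inr ⟨p, q, hp, not_le.mp hq, hqd, rfl⟩

/-- The set of generators `B_M ∪ B_N` is closed under Borel moves. -/
theorem exists_mem_add_single_eq {n : ℕ} {a b c d : Fin n} (h1 : c < a) (h2 : a ≤ b)
    {v : Fin n →₀ ℕ} (hv : v ∈ BM a b ∪ BN b c d) {i i' : Fin n} (hi : i < i')
    (hvi : v i' ≠ 0) :
    ∃ u ∈ BM a b ∪ BN b c d, u + single i' 1 = v + single i 1 := by
  obtain ⟨p, q, hpq, rfl⟩ := (mem_BM_union_BN_iff h1 h2).mp hv
  by_cases hp : p = i'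
  · subst hp
    refine ⟨single i 1 + single q 1, (mem_BM_union_BN_iff h1 h2).mpr ⟨i, q, ?_, rfl⟩, by abel⟩
    exact hpq.imp (fun h => ⟨hi.le.trans h.1, h.2⟩) fun h => ⟨hi.le.trans h.1, h.2⟩
  · obtain rfl : q = i' := by
      by_contra hq
      exact hvi (by simp [hp, hq])
    refine ⟨single p 1 + single i 1, (mem_BM_union_BN_iff h1 h2).mpr ⟨p, i, ?_, rfl⟩, by abel⟩
    exact hpq.imp (fun h => ⟨h.1, hi.le.trans h.2⟩) fun h => ⟨h.1, hi.le.trans h.2⟩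

theorem fiberMap_add {V W : Type*} (u : V → (W →₀ ℕ)) (T T' : V →₀ ℕ) :
    fiberMap u (T + T') = fiberMap u T + fiberMap u T' :=
  Finsupp.sum_add_index' (fun _ => zero_smul _ _) fun _ _ _ => add_smul _ _ _

theorem fiberMap_single_one {V W : Type*} (u : V → (W →₀ ℕ)) (v : V) :
    fiberMap u (single v 1) = u v := by
  simp [fiberMap]

theorem single_le_of_mem_support {V : Type*} {T : V →₀ ℕ} {v : V} (hv : v ∈ T.support) :
    single v 1 ≤ T :=
  Finsupp.single_le_iff.mpr (Nat.one_le_iff_ne_zero.mpr (Finsupp.mem_support_iff.mp hv))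

theorem le_fiberMap {V W : Type*} (u : V → (W →₀ ℕ)) {T : V →₀ ℕ} {v : V}
    (hv : v ∈ T.support) : u v ≤ fiberMap u T := by
  obtain ⟨R, rfl⟩ := exists_add_of_le (single_le_of_mem_support hv)
  rw [fiberMap_add, fiberMap_single_one]
  exact le_self_add

theorem exists_mem_support_of_fiberMap_apply_ne_zero {V W : Type*} {u : V → (W →₀ ℕ)}
    {T : V →₀ ℕ} {k : W} (h : fiberMap u T k ≠ 0) : ∃ v ∈ T.support, u v k ≠ 0 := by
  rw [fiberMap, Finsupp.sum, Finsupp.finsetSum_apply] at h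
  obtain ⟨v, hv, hne⟩ := Finset.exists_ne_zero_of_sum_ne_zero h
  exact ⟨v, hv, fun h0 => hne (by simp [h0])⟩

/-- If `x_{i'} x_j` is the smallest divisor of `μ` in `S`, then a monomial `T` in the fiber of
`μ` with a factor `x_i x_j`, `i < i'`, all of whose factors exceed `x_{i'} x_j`, has an edge to
a monomial whose smallest factor in `S` is `x_{i'} x_j`. -/
theorem exists_reduces_isLeastFactorIn {n : ℕ} {a b c d : Fin n} (h1 : c < a) (h2 : a ≤ b)
    {S : Set (Fin n →₀ ℕ)} {T : ↥(BM a b ∪ BN b c d) →₀ ℕ} {w₀ P : ↥(BM a b ∪ BN b c d)}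
    {i i' j : Fin n} (hi : i < i')
    (hw : (w₀ : Fin n →₀ ℕ) = single i 1 + single j 1)
    (hP : (P : Fin n →₀ ℕ) = single i' 1 + single j 1)
    (hwT : w₀ ∈ T.support)
    (hPle : IsLeastDivisorIn S
      (fiberMap (fun w : ↥(BM a b ∪ BN b c d) => (w : Fin n →₀ ℕ)) T) P)
    (hgt : ∀ v ∈ T.support, RlexGt (v : Fin n →₀ ℕ) P) :
    ∃ T' : ↥(BM a b ∪ BN b c d) →₀ ℕ,
      Reduces (G1 a b c d) T T' ∧
      fiberMap (fun w : ↥(BM a b ∪ BN b c d) => (w : Fin n →₀ ℕ)) T' =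
        fiberMap (fun w : ↥(BM a b ∪ BN b c d) => (w : Fin n →₀ ℕ)) T ∧
      IsLeastFactorIn S T' P := by
  obtain ⟨hPS, hPμ, hPmin⟩ := hPle
  obtain ⟨R, hTR⟩ : ∃ R, T = single w₀ 1 + R :=
    exists_add_of_le (single_le_of_mem_support hwT)
  have hR : fiberMap (fun w : ↥(BM a b ∪ BN b c d) => (w : Fin n →₀ ℕ)) R i' ≠ 0 := by
    have h := hPμ i'
    rw [hTR, fiberMap_add, fiberMap_single_one] at h
    simp only [hw, hP, Finsupp.add_apply, Finsupp.single_eq_same,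
      Finsupp.single_eq_of_ne hi.ne'] at h
    omega
  obtain ⟨v, hvR, hvi⟩ := exists_mem_support_of_fiberMap_apply_ne_zero hR
  obtain ⟨Q, hRQ⟩ : ∃ Q, R = single v 1 + Q :=
    exists_add_of_le (single_le_of_mem_support hvR)
  obtain ⟨u, hu, huv⟩ := exists_mem_add_single_eq h1 h2 v.2 hi hvi
  obtain ⟨u', rfl⟩ : ∃ u' : ↥(BM a b ∪ BN b c d), (u' : Fin n →₀ ℕ) = u := ⟨⟨u, hu⟩, rfl⟩
  have hTQ : T = single w₀ 1 + single v 1 + Q := by rw [hTR, hRQ, add_assoc]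
  have hvT : v ∈ T.support := by simp [hTQ]
  have hsum : (w₀ : Fin n →₀ ℕ) + v = u' + P := by
    rw [hw, hP, ← add_assoc, huv]
    abel
  obtain ⟨T', hT'⟩ : ∃ T', T' = Q + (single u' 1 + single P 1) := ⟨_, rfl⟩
  have hfib : fiberMap (fun w : ↥(BM a b ∪ BN b c d) => (w : Fin n →₀ ℕ)) T' =
      fiberMap (fun w : ↥(BM a b ∪ BN b c d) => (w : Fin n →₀ ℕ)) T := by
    rw [hT', hTQ]
    simp only [fiberMap_add, fiberMap_single_one]
    rw [← hsum, add_comm]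
  refine ⟨T', ⟨⟨single w₀ 1 + single v 1, single u' 1 + single P 1⟩,
    ⟨w₀, v, u', P, hsum, hgt w₀ hwT, hgt v hvT, rfl, rfl⟩, ?_, ?_⟩, hfib, ?_, hPS, ?_⟩
  · rw [hTQ]
    exact le_self_add
  · rw [hT', hTQ, add_tsub_cancel_left]
  · simp [hT']
  · intro x hx hxS
    have hxμ := le_fiberMap (fun w : ↥(BM a b ∪ BN b c d) => (w : Fin n →₀ ℕ)) hx
    rw [hfib] at hxμ
    exact (hPmin x hxS hxμ).imp_left fun h => Subtype.ext h

/-- Let `I = B(x_a x_b, x_c x_d)` with `c < a ≤ b < d`, and let `T` be a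
vertex of the fiber graph `Γ_μ(I)` with respect to `G₁`. (a) If `T` has a smallest
variable factor `L_N(T) = T_{w₀}` from `B_N` and `w₀ ≠ N'`, then there is an edge from
`T` to a vertex `T'` with `L_N(T) > L_N(T') ≥ T_{N'}`. (b) If `T` has no factor from
`B_N`, has a smallest factor `L_M(T) = T_{w₀}` from `B_M`, and `w₀ ≠ M'`, then there is
an edge from `T` to a vertex `T'` with `L_M(T) > L_M(T') ≥ T_{M'}`. -/
theorem fiberGraph_moves_rlex {n : ℕ} (a b c d : Fin n)
    (h1 : c < a) (h2 : a ≤ b) (h3 : b < d)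
    (μ : Fin n →₀ ℕ) (T : ↥(BM a b ∪ BN b c d) →₀ ℕ)
    (hT : fiberMap (fun w : ↥(BM a b ∪ BN b c d) => (w : Fin n →₀ ℕ)) T = μ) :
    (∀ (w₀ : ↥(BM a b ∪ BN b c d)) (N' : Fin n →₀ ℕ),
      IsLeastFactorIn (BN b c d) T w₀ → IsLeastDivisorIn (BN b c d) μ N' →
        (w₀ : Fin n →₀ ℕ) ≠ N' →
        ∃ (T' : ↥(BM a b ∪ BN b c d) →₀ ℕ) (w₁ : ↥(BM a b ∪ BN b c d)),
          Reduces (G1 a b c d) T T' ∧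
          fiberMap (fun w : ↥(BM a b ∪ BN b c d) => (w : Fin n →₀ ℕ)) T' = μ ∧
          IsLeastFactorIn (BN b c d) T' w₁ ∧
          RlexGt (w₀ : Fin n →₀ ℕ) (w₁ : Fin n →₀ ℕ) ∧
          ((w₁ : Fin n →₀ ℕ) = N' ∨ RlexGt (w₁ : Fin n →₀ ℕ) N')) ∧
    ((∀ v ∈ T.support, (v : Fin n →₀ ℕ) ∉ BN b c d) →
      ∀ (w₀ : ↥(BM a b ∪ BN b c d)) (M' : Fin n →₀ ℕ),
        IsLeastFactorIn (BM a b) T w₀ → IsLeastDivisorIn (BM a b) μ M' →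
          (w₀ : Fin n →₀ ℕ) ≠ M' →
          ∃ (T' : ↥(BM a b ∪ BN b c d) →₀ ℕ) (w₁ : ↥(BM a b ∪ BN b c d)),
            Reduces (G1 a b c d) T T' ∧
            fiberMap (fun w : ↥(BM a b ∪ BN b c d) => (w : Fin n →₀ ℕ)) T' = μ ∧
            IsLeastFactorIn (BM a b) T' w₁ ∧
            RlexGt (w₀ : Fin n →₀ ℕ) (w₁ : Fin n →₀ ℕ) ∧
            ((w₁ : Fin n →₀ ℕ) = M' ∨ RlexGt (w₁ : Fin n →₀ ℕ) M')) := by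
  subst hT
  refine ⟨?_, ?_⟩
  · rintro w₀ _ ⟨hwT, hwN, hwmin⟩ hN hne
    obtain ⟨⟨i', j', hi'c, hbj', hj'd, rfl⟩, hNμ, hNmin⟩ := id hN
    have hwN' := (hNmin w₀ hwN (le_fiberMap _ hwT)).resolve_left hne
    obtain ⟨i, j, hic, hbj, hjd, hw⟩ := hwN
    have hcb : c < b := h1.trans_le h2
    have hi'j' : i' ≤ j' := (hi'c.trans_lt (hcb.trans hbj')).le
    have hij : i ≤ j := (hic.trans_lt (hcb.trans hbj)).le
    have hBM : ∀ v ∈ BM a b, ∀ l, b < l → v l = 0 := by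
      rintro _ ⟨p, q, hpq, -, hq, rfl⟩ l hl
      exact single_add_single_apply_eq_zero hpq (hq.trans_lt hl)
    have hjj' : j ≤ j' := le_of_eq_or_rlexGt (Or.inr hwN')
      (fun l hl => single_add_single_apply_eq_zero hi'j' hl) (by simp [hw])
    have hj'j : j' ≤ j := by
      have hμj' : fiberMap (fun w : ↥(BM a b ∪ BN b c d) => (w : Fin n →₀ ℕ)) T j' ≠ 0 := by
        have := hNμ j'
        simp only [Finsupp.add_apply, Finsupp.single_eq_same] at this
        omega
      obtain ⟨v, hvT, hvj'⟩ := exists_mem_support_of_fiberMap_apply_ne_zero hμj'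
      have hvN := v.2.resolve_left fun h => hvj' (hBM v h j' hbj')
      refine le_of_eq_or_rlexGt ((hwmin v hvT hvN).imp_left (congrArg Subtype.val))
        (fun l hl => ?_) hvj'
      rw [hw]
      exact single_add_single_apply_eq_zero hij hl
    obtain rfl := le_antisymm hjj' hj'j
    have hi : i < i' := lt_of_rlexGt_single_add_single (hw ▸ hwN')
    obtain ⟨T', hred, hfib, hleast⟩ := exists_reduces_isLeastFactorIn h1 h2
      (P := ⟨_, Or.inr hN.1⟩) hi hw rfl hwT hN fun v hvT => by
        rcases v.2 with hv | hv
        · refine ⟨j, ?_, fun l hl => ?_⟩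
          · simp [hBM v hv j hbj]
          · exact (hBM v hv l (hbj.trans hl)).trans
              (single_add_single_apply_eq_zero hi'j' hl).symm
        · rcases hwmin v hvT hv with rfl | h
          · exact hwN'
          · exact h.trans hwN'
    exact ⟨T', _, hred, hfib, hleast, hwN', Or.inl rfl⟩
  · rintro hTM w₀ _ ⟨hwT, hwM, hwmin⟩ hM hne
    obtain ⟨⟨i', j', hi'j', hi'a, hj'b, rfl⟩, hMμ, hMmin⟩ := id hM
    have hwM' := (hMmin w₀ hwM (le_fiberMap _ hwT)).resolve_left hne
    obtain ⟨i, j, hij, hia, hjb, hw⟩ := hwM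
    have hmin : ∀ v ∈ T.support, v = w₀ ∨ RlexGt (v : Fin n →₀ ℕ) w₀ := fun v hvT =>
      hwmin v hvT (v.2.resolve_right (hTM v hvT))
    have hjj' : j ≤ j' := le_of_eq_or_rlexGt (Or.inr hwM')
      (fun l hl => single_add_single_apply_eq_zero hi'j' hl) (by simp [hw])
    have hj'j : j' ≤ j := by
      have hμj' : fiberMap (fun w : ↥(BM a b ∪ BN b c d) => (w : Fin n →₀ ℕ)) T j' ≠ 0 := by
        have := hMμ j'
        simp only [Finsupp.add_apply, Finsupp.single_eq_same] at this
        omega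
      obtain ⟨v, hvT, hvj'⟩ := exists_mem_support_of_fiberMap_apply_ne_zero hμj'
      refine le_of_eq_or_rlexGt ((hmin v hvT).imp_left (congrArg Subtype.val))
        (fun l hl => ?_) hvj'
      rw [hw]
      exact single_add_single_apply_eq_zero hij hl
    obtain rfl := le_antisymm hjj' hj'j
    have hi : i < i' := lt_of_rlexGt_single_add_single (hw ▸ hwM')
    obtain ⟨T', hred, hfib, hleast⟩ := exists_reduces_isLeastFactorIn h1 h2
      (P := ⟨_, Or.inl hM.1⟩) hi hw rfl hwT hM fun v hvT => by
        rcases hmin v hvT with rfl | h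
        · exact hwM'
        · exact h.trans hwM'
    exact ⟨T', _, hred, hfib, hleast, hwM', Or.inl rfl⟩
end
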